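/- arXiv:2502.20692 — 3 statements merged into one kernel-verified Lean document; each statement's English description precedes it below -/
import Mathlib

section
/- Let f be a natural number and set n = 3*f + 1. Identify validators with elements of Fin n and let the leader of view v ∈ ℕ be the residue v mod n (as an element of Fin n). Let F ⊆ Fin n be any subset (of faulty validators) with Finset.card F ≤ f. Then for every starting view v₀ ∈ ℕ, there exists a view v with v₀ ≤ v and v ≤ v₀ + 3*f such that the leaders of the three consecutive views v, v+1, v+2 are all correct, i.e. (v mod n) ∉ F, ((v+1) mod n) ∉ F, and ((v+2) mod n) ∉ F. In particular, any sequence of 3*f + 3 consecutive views contains a group of three consecutive views each of which has a correct leader. -/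
open scoped Pointwise in
/-- If `#F * #S < #G`, some translate of `S` in the finite group `G` avoids `F`. -/
theorem Finset.exists_forall_add_notMem {G : Type*} [AddGroup G] [Fintype G] [DecidableEq G]
    (F S : Finset G) (h : F.card * S.card < Fintype.card G) :
    ∃ x : G, ∀ s ∈ S, x + s ∉ F := by
  obtain ⟨x, hx⟩ : ∃ x, x ∉ F - S := by
    by_contra! hall
    have hcard := Finset.card_sub_le (s := F) (t := S)
    rw [Finset.eq_univ_of_forall hall, Finset.card_univ] at hcard
    omega
  refine ⟨x, fun s hs hxs => hx ?_⟩
  simpa using Finset.sub_mem_sub hxs hs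

theorem Fin.ofNat_add_eq_add_ofNat {n : ℕ} [NeZero n] (a b : ℕ) :
    Fin.ofNat n (a + b) = Fin.ofNat n a + Fin.ofNat n b :=
  Fin.ext (Nat.add_mod a b n)

/-- Every residue class modulo `n` is attained in any window of `n` consecutive naturals. -/
theorem Fin.exists_ofNat_eq_of_window {n : ℕ} [NeZero n] (x : Fin n) (a : ℕ) :
    ∃ v, a ≤ v ∧ v < a + n ∧ Fin.ofNat n v = x := by
  refine ⟨a + (x - Fin.ofNat n a).val, by omega, by omega, ?_⟩
  rw [Fin.ofNat_add_eq_add_ofNat, Fin.ofNat_val_eq_self, add_sub_cancel]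

/-- Round-robin leaders: in any sequence of `3*f + 3` consecutive views there
exist three consecutive views whose leaders are all correct. -/
theorem three_consecutive_correct_leaders (f : ℕ)
    (F : Finset (Fin (3 * f + 1))) (hF : F.card ≤ f) (v₀ : ℕ) :
    ∃ v : ℕ, v₀ ≤ v ∧ v ≤ v₀ + 3 * f ∧
      (⟨v % (3 * f + 1), Nat.mod_lt v (by omega)⟩ : Fin (3 * f + 1)) ∉ F ∧
      (⟨(v + 1) % (3 * f + 1), Nat.mod_lt (v + 1) (by omega)⟩ : Fin (3 * f + 1)) ∉ F ∧
      (⟨(v + 2) % (3 * f + 1), Nat.mod_lt (v + 2) (by omega)⟩ : Fin (3 * f + 1)) ∉ F := by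
  let leader := Fin.ofNat (3 * f + 1)
  have hcard : F.card * ({leader 0, leader 1, leader 2} : Finset _).card
      < Fintype.card (Fin (3 * f + 1)) := by
    rw [Fintype.card_fin]
    have := Nat.mul_le_mul hF (Finset.card_le_three (a := leader 0) (b := leader 1) (c := leader 2))
    omega
  obtain ⟨x, hx⟩ := F.exists_forall_add_notMem _ hcard
  obtain ⟨v, hle, hlt, rfl⟩ := x.exists_ofNat_eq_of_window v₀
  have hcorrect (k : ℕ) (hk : leader k ∈ ({leader 0, leader 1, leader 2} : Finset _)) :
      leader (v + k) ∉ F := by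
    rw [show leader (v + k) = leader v + leader k from Fin.ofNat_add_eq_add_ofNat v k]
    exact hx _ hk
  exact ⟨v, hle, by omega, hcorrect 0 (by simp), hcorrect 1 (by simp), hcorrect 2 (by simp)⟩
end

section
/- Let f be a natural number, U a finite set with Finset.card U = 3*f + 1, and F ⊆ U with Finset.card F ≤ f. Let N ⊆ U with Finset.card N ≥ 2*f + 1 and let V ⊆ U be such that V ∩ N ⊆ F (no correct validator lies in both V and N). Then Finset.card V ≤ 2*f; in particular there is no subset Q ⊆ V with Finset.card Q ≥ 2*f + 1. -/
/-- NEC soundness: if a quorum `N` issued no-endorsement messages and no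
correct validator lies in both the voter set `V` and `N`, then `V` has at most
`2*f` members; in particular `V` contains no quorum. -/
theorem nec_sound {α : Type*} [DecidableEq α] (f : ℕ)
    (U F : Finset α) (hU : U.card = 3 * f + 1) (hF : F ⊆ U) (hFc : F.card ≤ f)
    (N V : Finset α) (hN : N ⊆ U) (hNc : 2 * f + 1 ≤ N.card)
    (hV : V ⊆ U) (hVN : V ∩ N ⊆ F) :
    V.card ≤ 2 * f ∧ ¬ ∃ Q : Finset α, Q ⊆ V ∧ 2 * f + 1 ≤ Q.card := by
  have hcard : V.card ≤ 2 * f := by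
    have hunion := Finset.card_le_card (Finset.union_subset hV hN)
    have hinter := Finset.card_le_card hVN
    have hsum := Finset.card_union_add_card_inter V N
    omega
  refine ⟨hcard, ?_⟩
  rintro ⟨Q, hQV, hQ⟩
  have hQcard := Finset.card_le_card hQV
  omega
end

section
/- Let f be a natural number, U a finite set with Finset.card U = 3*f + 1, Q ⊆ U with Finset.card Q ≥ 2*f + 1, and S ⊆ U with Finset.card S ≥ f + 1. Let T be an arbitrary type of tips, g a T-valued function on the underlying type (assigning to each validator its reported tip), h : T → ℕ (assigning to each tip its view), v a natural number, and t : T. Assume: (i) every i ∈ Q satisfies h (g i) ≤ v; (ii) every i ∈ S satisfies g i = t; (iii) h t = v; and (iv) non-equivocation: every t' : T with h t' = v equals t. Then for every i* ∈ Q that maximizes h ∘ g over Q (i.e. every j ∈ Q satisfies h (g j) ≤ h (g i*)), one has h (g i*) = v and g i* = t. -/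
/-- Core of tail-forking resistance: if `f + 1` correct validators all report
the honest tip `t` of view `v` (the only tip of view `v`, by non-equivocation)
and all quorum reports have view at most `v`, then any view-maximizing report
in the quorum equals `t`. -/
theorem high_tip_is_honest_tip {α T : Type*} [DecidableEq α] (f : ℕ)
    (U Q S : Finset α) (hU : U.card = 3 * f + 1)
    (hQ : Q ⊆ U) (hQc : 2 * f + 1 ≤ Q.card)
    (hS : S ⊆ U) (hSc : f + 1 ≤ S.card)
    (g : α → T) (h : T → ℕ) (v : ℕ) (t : T)
    (hvalid : ∀ i ∈ Q, h (g i) ≤ v)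
    (hreport : ∀ i ∈ S, g i = t)
    (htv : h t = v)
    (hnoequiv : ∀ t' : T, h t' = v → t' = t) :
    ∀ iStar ∈ Q, (∀ j ∈ Q, h (g j) ≤ h (g iStar)) →
      h (g iStar) = v ∧ g iStar = t := by
  intro iStar hiStar hmax
  obtain ⟨j, hj⟩ := Finset.inter_nonempty_of_card_lt_card_add_card hQ hS (by omega)
  obtain ⟨hjQ, hjS⟩ := Finset.mem_inter.mp hj
  have hle : v ≤ h (g iStar) := by
    simpa only [hreport j hjS, htv] using hmax j hjQ
  have hview : h (g iStar) = v := le_antisymm (hvalid iStar hiStar) hle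
  exact ⟨hview, hnoequiv _ hview⟩
end
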